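/- Let 𝔤 be a finite-dimensional complex simple Lie algebra, 𝔥 ⊆ 𝔤 a Cartan subalgebra, Φ⁺ a set of positive roots of Φ(𝔤,𝔥), and σ : 𝔤 → 𝔤 a conjugate-linear involution with σ(𝔥) = 𝔥 and σ*(Φ⁺) = Φ⁺. For each α ∈ Φ⁺ choose x_α ∈ 𝔤_α and x_{−α} ∈ 𝔤_{−α} with κ(x_α, x_{−α}) = 1, and set S = Σ_{α∈Φ⁺} (x_{−α} ⊗ x_α − x_α ⊗ x_{−α}) ∈ 𝔤 ⊗ 𝔤. Then (σ ⊗ σ)(S) = S, where σ ⊗ σ is the real-linear map on 𝔤 ⊗ 𝔤 with (σ ⊗ σ)(u ⊗ v) = σ(u) ⊗ σ(v). -/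

import Mathlib

open scoped TensorProduct BigOperators

/-- A conjugate-linear involutive Lie algebra automorphism of a complex Lie algebra. -/
def IsConjLinearInvolution {L : Type*} [LieRing L] [LieAlgebra ℂ L] (σ : L → L) : Prop :=
  (∀ x y : L, σ (x + y) = σ x + σ y) ∧
  (∀ (z : ℂ) (x : L), σ (z • x) = (starRingEnd ℂ) z • σ x) ∧
  (∀ x y : L, σ ⁅x, y⁆ = ⁅σ x, σ y⁆) ∧
  (∀ x : L, σ (σ x) = x)

/-- `x` is a root vector for the functional `α` on the Cartan subalgebra `H`. -/
def IsRootVector {L : Type*} [LieRing L] [LieAlgebra ℂ L] (H : LieSubalgebra ℂ L)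
    (α : H → ℂ) (x : L) : Prop :=
  ∀ h : H, ⁅(h : L), x⁆ = α h • x

/-- `α` is a root of `(L, H)`: a nonzero functional admitting a nonzero root vector. -/
def IsRoot {L : Type*} [LieRing L] [LieAlgebra ℂ L] (H : LieSubalgebra ℂ L)
    (α : H → ℂ) : Prop :=
  α ≠ 0 ∧ ∃ x : L, x ≠ 0 ∧ IsRootVector H α x

/-- `P` is a system of positive roots: a set of roots containing exactly one of `β`, `-β`
for each root `β`, and closed under addition of roots. -/
def IsPositiveSystem {L : Type*} [LieRing L] [LieAlgebra ℂ L] (H : LieSubalgebra ℂ L)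
    (P : Finset (H → ℂ)) : Prop :=
  (∀ α ∈ P, IsRoot H α) ∧
  (∀ β : H → ℂ, IsRoot H β → (β ∈ P ∨ -β ∈ P)) ∧
  (∀ β ∈ P, -β ∉ P) ∧
  (∀ α ∈ P, ∀ β ∈ P, IsRoot H (α + β) → α + β ∈ P)

/-- The functional `σ*(α)`, given by `σ*(α)(h) = conj (α (σ h))`. -/
def sigmaStar {L : Type*} [LieRing L] [LieAlgebra ℂ L] (H : LieSubalgebra ℂ L)
    (σ : L → L) (hH : ∀ x ∈ H, σ x ∈ H) (α : H → ℂ) : H → ℂ :=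
  fun h => (starRingEnd ℂ) (α ⟨σ (h : L), hH (h : L) h.2⟩)

namespace IsConjLinearInvolution

variable {L : Type*} [LieRing L] [LieAlgebra ℂ L] {σ : L → L}

/-- The basis of `L` obtained by applying a conjugate-linear involution to a basis. -/
noncomputable def mapBasis (hσ : IsConjLinearInvolution σ) {ι : Type*} [Finite ι]
    (b : Module.Basis ι ℂ L) : Module.Basis ι ℂ L :=
  .ofEquivFun
    { toFun := fun x i => (starRingEnd ℂ) (b.equivFun (σ x) i)
      invFun := fun c => σ (b.equivFun.symm fun i => (starRingEnd ℂ) (c i))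
      map_add' := fun x y => by ext i; simp [hσ.1]
      map_smul' := fun c x => by ext i; simp [hσ.2.1]
      left_inv := fun x => by
        simp only [starRingEnd_self_apply]
        exact (congrArg σ (b.equivFun.symm_apply_apply (σ x))).trans (hσ.2.2.2 x)
      right_inv := fun c => by ext i; simp [hσ.2.2.2] }

lemma mapBasis_apply (hσ : IsConjLinearInvolution σ) {ι : Type*} [Finite ι]
    (b : Module.Basis ι ℂ L) (i : ι) : hσ.mapBasis b i = σ (b i) := by
  classical
  have h : (fun j => (starRingEnd ℂ) ((Pi.single i 1 : ι → ℂ) j)) = Pi.single i 1 := by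
    ext j
    by_cases hj : j = i <;> simp [hj]
  rw [mapBasis, Module.Basis.coe_ofEquivFun]
  change σ (b.equivFun.symm fun j => (starRingEnd ℂ) ((Pi.single i 1 : ι → ℂ) j)) = σ (b i)
  rw [h]
  simp

lemma mapBasis_repr (hσ : IsConjLinearInvolution σ) {ι : Type*} [Finite ι]
    (b : Module.Basis ι ℂ L) (x : L) (i : ι) :
    (hσ.mapBasis b).repr x i = (starRingEnd ℂ) (b.repr (σ x) i) := by
  rw [← Module.Basis.equivFun_apply, mapBasis, Module.Basis.equivFun_ofEquivFun]
  rfl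

lemma trace_eq_conj (hσ : IsConjLinearInvolution σ) [FiniteDimensional ℂ L]
    {f g : L →ₗ[ℂ] L} (hfg : ∀ x, g (σ x) = σ (f x)) :
    LinearMap.trace ℂ L g = (starRingEnd ℂ) (LinearMap.trace ℂ L f) := by
  let b := Module.finBasis ℂ L
  rw [LinearMap.trace_eq_matrix_trace ℂ b f, LinearMap.trace_eq_matrix_trace ℂ (hσ.mapBasis b) g]
  simp only [Matrix.trace, Matrix.diag_apply, LinearMap.toMatrix_apply, map_sum]
  refine Finset.sum_congr rfl fun i _ => ?_
  rw [mapBasis_repr, mapBasis_apply, hfg, hσ.2.2.2]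

lemma killingForm_apply (hσ : IsConjLinearInvolution σ) [FiniteDimensional ℂ L] (x y : L) :
    killingForm ℂ L (σ x) (σ y) = (starRingEnd ℂ) (killingForm ℂ L x y) := by
  rw [killingForm_apply_apply, killingForm_apply_apply]
  exact hσ.trace_eq_conj fun z => by simp [hσ.2.2.1]

lemma isRootVector_sigmaStar (hσ : IsConjLinearInvolution σ) {H : LieSubalgebra ℂ L}
    (hH : ∀ x ∈ H, σ x ∈ H) {α : H → ℂ} {x : L} (hx : IsRootVector H α x) :
    IsRootVector H (sigmaStar H σ hH α) (σ x) := fun h => by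
  have := congrArg σ (hx ⟨σ h, hH h h.2⟩)
  simpa [hσ.2.2.1, hσ.2.1, hσ.2.2.2, sigmaStar] using this

lemma sigmaStar_sigmaStar (hσ : IsConjLinearInvolution σ) {H : LieSubalgebra ℂ L}
    (hH : ∀ x ∈ H, σ x ∈ H) (α : H → ℂ) :
    sigmaStar H σ hH (sigmaStar H σ hH α) = α := by
  ext h
  simp [sigmaStar, hσ.2.2.2]

end IsConjLinearInvolution

lemma sigmaStar_neg {L : Type*} [LieRing L] [LieAlgebra ℂ L] {σ : L → L} {H : LieSubalgebra ℂ L}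
    (hH : ∀ x ∈ H, σ x ∈ H) (α : H → ℂ) :
    sigmaStar H σ hH (-α) = -sigmaStar H σ hH α := by
  ext h
  simp [sigmaStar]

lemma IsRootVector.exists_eq_smul {L : Type*} [LieRing L] [LieAlgebra ℂ L] [FiniteDimensional ℂ L]
    [LieAlgebra.IsKilling ℂ L] {H : LieSubalgebra ℂ L} [H.IsCartanSubalgebra]
    {α : H → ℂ} (hα : α ≠ 0) {x y : L} (hx : IsRootVector H α x) (hx0 : x ≠ 0)
    (hy : IsRootVector H α y) : ∃ c : ℂ, y = c • x := by
  have mem {z : L} (hz : IsRootVector H α z) : z ∈ LieAlgebra.rootSpace H α :=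
    LieModule.weightSpace_le_genWeightSpace L α ((LieModule.mem_weightSpace α z).mpr hz)
  let w : LieModule.Weight ℂ H L :=
    ⟨α, fun h => hx0 (by simpa [h] using mem hx)⟩
  obtain ⟨c, hc⟩ := (finrank_eq_one_iff_of_nonzero' (⟨x, mem hx⟩ : LieAlgebra.rootSpace H α)
    (by simpa using hx0)).mp (LieAlgebra.IsKilling.finrank_rootSpace_eq_one w hα) ⟨y, mem hy⟩
  exact ⟨c, by simpa using congrArg Subtype.val hc.symm⟩

/-- Root vectors for `α` and `-α` paired to `1` by the Killing form have a tensor product which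
does not depend on the choice of these vectors. -/
lemma IsRootVector.tmul_eq_tmul {L : Type*} [LieRing L] [LieAlgebra ℂ L] [FiniteDimensional ℂ L]
    [LieAlgebra.IsKilling ℂ L] {H : LieSubalgebra ℂ L} [H.IsCartanSubalgebra]
    {α : H → ℂ} (hα : α ≠ 0) {x x' y y' : L}
    (hx : IsRootVector H α x) (hy : IsRootVector H (-α) y) (hxy : killingForm ℂ L x y = 1)
    (hx' : IsRootVector H α x') (hy' : IsRootVector H (-α) y')
    (hxy' : killingForm ℂ L x' y' = 1) :
    x' ⊗ₜ[ℂ] y' = x ⊗ₜ[ℂ] y ∧ y' ⊗ₜ[ℂ] x' = y ⊗ₜ[ℂ] x := by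
  have hx0 : x ≠ 0 := by rintro rfl; simp at hxy
  have hy0 : y ≠ 0 := by rintro rfl; simp at hxy
  obtain ⟨c, rfl⟩ := hx.exists_eq_smul hα hx0 hx'
  obtain ⟨d, rfl⟩ := hy.exists_eq_smul (neg_ne_zero.mpr hα) hy0 hy'
  have hcd : c * d = 1 := by
    simpa only [map_smul, LinearMap.smul_apply, hxy, smul_eq_mul, mul_one, mul_comm d c] using hxy'
  constructor
  · rw [TensorProduct.smul_tmul_smul, hcd, one_smul]
  · rw [TensorProduct.smul_tmul_smul, mul_comm, hcd, one_smul]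

/-- if `σ*(Φ⁺) = Φ⁺` then the element
`S = Σ_{α ∈ Φ⁺} (x_{-α} ⊗ x_α - x_α ⊗ x_{-α})` satisfies `(σ ⊗ σ)(S) = S`. -/
theorem sigma_fixes_skew_casimir_of_stable
    (L : Type*) [LieRing L] [LieAlgebra ℂ L] [FiniteDimensional ℂ L]
    [LieAlgebra.IsSimple ℂ L]
    (H : LieSubalgebra ℂ L) [H.IsCartanSubalgebra]
    (P : Finset (H → ℂ)) (hP : IsPositiveSystem H P)
    (σ : L → L) (hσ : IsConjLinearInvolution σ)
    (hH : ∀ x ∈ H, σ x ∈ H)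
    (hstable : (sigmaStar H σ hH) '' (P : Set (H → ℂ)) = (P : Set (H → ℂ)))
    (x : (H → ℂ) → L)
    (hx : ∀ α ∈ P, IsRootVector H α (x α) ∧ IsRootVector H (-α) (x (-α)) ∧
      killingForm ℂ L (x α) (x (-α)) = 1) :
    ∑ α ∈ P, (σ (x (-α)) ⊗ₜ[ℂ] σ (x α) - σ (x α) ⊗ₜ[ℂ] σ (x (-α))) =
      ∑ α ∈ P, (x (-α) ⊗ₜ[ℂ] x α - x α ⊗ₜ[ℂ] x (-α)) := by
  have mem {α : H → ℂ} (hα : α ∈ P) : sigmaStar H σ hH α ∈ P := by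
    rw [← Finset.mem_coe, ← hstable]
    exact Set.mem_image_of_mem _ hα
  refine Finset.sum_nbij' (sigmaStar H σ hH) (sigmaStar H σ hH) (fun _ => mem) (fun _ => mem)
    (fun α _ => hσ.sigmaStar_sigmaStar hH α) (fun α _ => hσ.sigmaStar_sigmaStar hH α)
    fun α hα => ?_
  obtain ⟨hpos, hneg, hone⟩ := hx α hα
  obtain ⟨hpos', hneg', hone'⟩ := hx _ (mem hα)
  obtain ⟨h₁, h₂⟩ := IsRootVector.tmul_eq_tmul (hP.1 _ (mem hα)).1 hpos' hneg' hone'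
    (hσ.isRootVector_sigmaStar hH hpos)
    (sigmaStar_neg hH α ▸ hσ.isRootVector_sigmaStar hH hneg)
    (by rw [hσ.killingForm_apply, hone, map_one])
  rw [h₁, h₂]
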